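/- Let P be a poset. Then P is continuous if and only if P equipped with the Scott topology is a c-space. -/

import Mathlib

namespace RoughDomain

variable {P : Type*}

/-- `sRel r x` is the set `s_≺(x) = {y | y ≺ x}`. -/
def sRel [PartialOrder P] (r : P → P → Prop) (x : P) : Set P := {y | r y x}

/-- An auxiliary relation on a poset. -/
def IsAux [PartialOrder P] (r : P → P → Prop) : Prop :=
  (∀ x y, r x y → x ≤ y) ∧
  (∀ u x y z, u ≤ x → r x y → y ≤ z → r u z) ∧
  (∀ b : P, (∀ p, b ≤ p) → ∀ x, r b x)

/-- The downward closure `↓A`. -/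
def dcl [PartialOrder P] (A : Set P) : Set P := {z | ∃ a ∈ A, z ≤ a}

/-- Lower approximation `A^{↓≺} = {x ∈ A | s_≺(x) ∩ A ≠ ∅}`. -/
def lap [PartialOrder P] (r : P → P → Prop) (A : Set P) : Set P :=
  {x | x ∈ A ∧ (sRel r x ∩ A).Nonempty}

/-- Upper approximation `A^{↑≺} = {x | s_≺(x) ⊆ ↓A}`. -/
def uap [PartialOrder P] (r : P → P → Prop) (A : Set P) : Set P :=
  {x | sRel r x ⊆ dcl A}

/-- A directed subset of a poset (nonempty and upward directed). -/
def IsDir [PartialOrder P] (D : Set P) : Prop :=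
  D.Nonempty ∧ DirectedOn (· ≤ ·) D

/-- A pre-approximating auxiliary relation: each `s_≺(x)` is directed. -/
def IsPreApprox [PartialOrder P] (r : P → P → Prop) : Prop :=
  IsAux r ∧ ∀ x, IsDir (sRel r x)

/-- An approximating auxiliary relation: moreover `x = ⋁ s_≺(x)`. -/
def IsApprox [PartialOrder P] (r : P → P → Prop) : Prop :=
  IsPreApprox r ∧ ∀ x, IsLUB (sRel r x) x

/-- The way-below relation `x ≪ y`. -/
def wb [PartialOrder P] (x y : P) : Prop :=
  ∀ D : Set P, IsDir D → ∀ a, IsLUB D a → y ≤ a → ∃ d ∈ D, x ≤ d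

/-- A continuous poset: each `↡x` is directed with supremum `x`. -/
def IsContinuousPoset (P : Type*) [PartialOrder P] : Prop :=
  ∀ x : P, IsDir {y | wb y x} ∧ IsLUB {y | wb y x} x

/-- Scott open sets: upper sets inaccessible by existing directed suprema. -/
def ScottOpen [PartialOrder P] (U : Set P) : Prop :=
  IsUpperSet U ∧
    ∀ D : Set P, IsDir D → ∀ a, IsLUB D a → a ∈ U → (D ∩ U).Nonempty

/-- The Scott topology on a poset. -/
def scottTop (P : Type*) [PartialOrder P] : TopologicalSpace P where
  IsOpen := ScottOpen
  isOpen_univ :=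
    ⟨isUpperSet_univ, fun _D hD _a _ _ => hD.1.imp fun d hd => ⟨hd, trivial⟩⟩
  isOpen_inter := by
    rintro U V ⟨hU1, hU2⟩ ⟨hV1, hV2⟩
    refine ⟨hU1.inter hV1, fun D hD a ha haUV => ?_⟩
    obtain ⟨d1, hd1D, hd1U⟩ := hU2 D hD a ha haUV.1
    obtain ⟨d2, hd2D, hd2V⟩ := hV2 D hD a ha haUV.2
    obtain ⟨d, hdD, h1, h2⟩ := hD.2 d1 hd1D d2 hd2D
    exact ⟨d, hdD, hU1 h1 hd1U, hV1 h2 hd2V⟩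
  isOpen_sUnion := by
    intro S hS
    constructor
    · intro a b hab ha
      obtain ⟨U, hUS, haU⟩ := ha
      exact ⟨U, hUS, (hS U hUS).1 hab haU⟩
    · intro D hD a ha haU
      obtain ⟨U, hUS, haU⟩ := haU
      obtain ⟨d, hdD, hdU⟩ := (hS U hUS).2 D hD a ha haU
      exact ⟨d, hdD, U, hUS, hdU⟩

lemma lap_subset [PartialOrder P] (r : P → P → Prop) (A : Set P) :
    lap r A ⊆ A := fun _x hx => hx.1

/-- `≺`-open sets: upper sets `U` with `U = U^{↓≺}`. -/
def PrecOpen [PartialOrder P] (r : P → P → Prop) (U : Set P) : Prop :=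
  IsUpperSet U ∧ lap r U = U

/-- The topology `μ^≺(P)` of `≺`-open sets, for `≺` pre-approximating. -/
def muTop [PartialOrder P] (r : P → P → Prop) (h : IsPreApprox r) :
    TopologicalSpace P where
  IsOpen := PrecOpen r
  isOpen_univ := by
    refine ⟨isUpperSet_univ,
      Set.Subset.antisymm (lap_subset r _) fun x _ => ⟨trivial, ?_⟩⟩
    obtain ⟨y, hy⟩ := (h.2 x).1
    exact ⟨y, hy, trivial⟩
  isOpen_inter := by
    rintro U V ⟨hU1, hU2⟩ ⟨hV1, hV2⟩
    refine ⟨hU1.inter hV1,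
      Set.Subset.antisymm (lap_subset r _) fun x hx => ?_⟩
    have h1 : x ∈ lap r U := by rw [hU2]; exact hx.1
    have h2 : x ∈ lap r V := by rw [hV2]; exact hx.2
    obtain ⟨y1, hy1r, hy1U⟩ := h1.2
    obtain ⟨y2, hy2r, hy2V⟩ := h2.2
    obtain ⟨y, hyr, hle1, hle2⟩ := (h.2 x).2 y1 hy1r y2 hy2r
    exact ⟨hx, y, hyr, hU1 hle1 hy1U, hV1 hle2 hy2V⟩
  isOpen_sUnion := by
    intro S hS
    constructor
    · intro a b hab ha
      obtain ⟨U, hUS, haU⟩ := ha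
      exact ⟨U, hUS, (hS U hUS).1 hab haU⟩
    · refine Set.Subset.antisymm (lap_subset r _) fun x hx => ?_
      obtain ⟨U, hUS, hxU⟩ := hx
      have h1 : x ∈ lap r U := by rw [(hS U hUS).2]; exact hxU
      obtain ⟨y, hyr, hyU⟩ := h1.2
      exact ⟨⟨U, hUS, hxU⟩, y, hyr, U, hUS, hyU⟩

/-- A c-space: every point of an open set is in the interior of `↑y`
(with respect to the specialization preorder) for some `y` in that open set. -/
def IsCSpace (X : Type*) [TopologicalSpace X] : Prop :=
  ∀ x : X, ∀ U : Set X, IsOpen U → x ∈ U →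
    ∃ y ∈ U, x ∈ interior {z | ∀ V : Set X, IsOpen V → y ∈ V → z ∈ V}

/-- Complete distributivity of a complete lattice. -/
def CompletelyDistrib (L : Type*) [CompleteLattice L] : Prop :=
  ∀ {ι : Type*} {κ : ι → Type*} (f : ∀ i : ι, κ i → L),
    ⨅ i, ⨆ j, f i j = ⨆ g : ∀ i, κ i, ⨅ i, f i (g i)

/-- `A' `: the set of suprema of directed subsets of `↓A`. -/
def oneStep [PartialOrder P] (A : Set P) : Set P :=
  {x | ∃ D : Set P, IsDir D ∧ D ⊆ dcl A ∧ IsLUB D x}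

theorem wb_le [PartialOrder P] {x y : P} (h : wb x y) : x ≤ y := by
  obtain ⟨d, hd, hle⟩ := h {y} ⟨⟨y, rfl⟩, by
    rintro a rfl b rfl
    exact ⟨_, rfl, le_rfl, le_rfl⟩⟩ y isLUB_singleton le_rfl
  rw [Set.mem_singleton_iff] at hd
  exact hd ▸ hle

theorem wb_mono [PartialOrder P] {u x y z : P} (h1 : u ≤ x) (h : wb x y) (h2 : y ≤ z) :
    wb u z := by
  intro D hD a ha hza
  obtain ⟨d, hd, hxd⟩ := h D hD a ha (h2.trans hza)
  exact ⟨d, hd, h1.trans hxd⟩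

theorem wb_interp [PartialOrder P] (hP : IsContinuousPoset P) {y x : P} (h : wb y x) :
    ∃ z, wb y z ∧ wb z x := by
  obtain ⟨d, ⟨z, hdz, hzx⟩, hyd⟩ := h {w | ∃ z, wb w z ∧ wb z x} (by
    constructor
    · obtain ⟨z, hz⟩ := (hP x).1.1
      obtain ⟨w, hw⟩ := (hP z).1.1
      exact ⟨w, z, hw, hz⟩
    · rintro w1 ⟨z1, hw1, hz1⟩ w2 ⟨z2, hw2, hz2⟩
      obtain ⟨z, hz, h1, h2⟩ := (hP x).1.2 z1 hz1 z2 hz2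
      obtain ⟨w, hw, h3, h4⟩ :=
        (hP z).1.2 w1 (wb_mono le_rfl hw1 h1) w2 (wb_mono le_rfl hw2 h2)
      exact ⟨w, ⟨z, hw, hz⟩, h3, h4⟩) x (by
    constructor
    · rintro w ⟨z, hw, hz⟩
      exact (wb_le hw).trans (wb_le hz)
    · intro u hu
      refine (hP x).2.2 fun z hz => (hP z).2.2 fun w hw => hu ⟨z, hw, hz⟩) le_rfl
  exact ⟨z, wb_mono hyd hdz le_rfl, hzx⟩

theorem scottOpen_not_le [PartialOrder P] (u : P) : ScottOpen {w : P | ¬ w ≤ u} := by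
  refine ⟨fun a b hab ha hb => ha (hab.trans hb), fun D _ a ha hau => ?_⟩
  by_contra hne
  refine hau (ha.2 fun d hd => ?_)
  by_contra hdu
  exact hne ⟨d, hd, hdu⟩

theorem stmt16 (P : Type*) [PartialOrder P] :
    IsContinuousPoset P ↔ @IsCSpace P (scottTop P) := by
  constructor
  · intro hP x U hU hx
    obtain ⟨y, hyx, hyU⟩ := hU.2 _ (hP x).1 x (hP x).2 hx
    refine ⟨y, hyU, {z | wb y z}, ⟨?_, ?_⟩, hyx⟩
    · refine ⟨fun a b hab ha => wb_mono le_rfl ha hab, fun D hD a ha hya => ?_⟩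
      obtain ⟨z, hyz, hza⟩ := wb_interp hP hya
      obtain ⟨d, hd, hzd⟩ := hza D hD a ha le_rfl
      exact ⟨d, hd, wb_mono le_rfl hyz hzd⟩
    · intro z hz V hV hyV
      exact hV.1 (wb_le hz) hyV
  · intro hC x
    have key : ∀ U : Set P, ScottOpen U → x ∈ U →
        ∃ y ∈ U, ∃ V : Set P, ScottOpen V ∧ x ∈ V ∧ ∀ z ∈ V, y ≤ z := by
      intro U hU hx
      obtain ⟨y, hyU, V, ⟨hV, hVs⟩, hxV⟩ := hC x U hU hx
      refine ⟨y, hyU, V, hV, hxV, fun z hz => ?_⟩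
      by_contra hyz
      exact hVs hz _ (scottOpen_not_le z) hyz le_rfl
    have hwb : ∀ y V, ScottOpen V → x ∈ V → (∀ z ∈ V, y ≤ z) → wb y x := by
      intro y V hV hxV h D hD a ha hxa
      obtain ⟨d, hd, hdV⟩ := hV.2 D hD a ha (hV.1 hxa hxV)
      exact ⟨d, hd, h d hdV⟩
    have hdir : IsDir {y | ∃ V : Set P, ScottOpen V ∧ x ∈ V ∧ ∀ z ∈ V, y ≤ z} := by
      constructor
      · obtain ⟨y, _, h⟩ := key Set.univ (scottTop P).isOpen_univ trivial
        exact ⟨y, h⟩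
      · rintro y1 ⟨V1, hV1, hx1, h1⟩ y2 ⟨V2, hV2, hx2, h2⟩
        obtain ⟨y, hy, h⟩ := key (V1 ∩ V2) ((scottTop P).isOpen_inter _ _ hV1 hV2) ⟨hx1, hx2⟩
        exact ⟨y, h, h1 y hy.1, h2 y hy.2⟩
    have hlub : IsLUB {y | ∃ V : Set P, ScottOpen V ∧ x ∈ V ∧ ∀ z ∈ V, y ≤ z} x := by
      constructor
      · rintro y ⟨V, _, hx, h⟩
        exact h x hx
      · intro u hu
        by_contra hxu
        obtain ⟨y, hy, h⟩ := key _ (scottOpen_not_le u) hxu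
        exact hy (hu h)
    have heq : {y | wb y x} = {y | ∃ V : Set P, ScottOpen V ∧ x ∈ V ∧ ∀ z ∈ V, y ≤ z} := by
      ext y
      constructor
      · intro hy
        obtain ⟨e, ⟨V, hV, hx, h⟩, hye⟩ := hy _ hdir x hlub le_rfl
        exact ⟨V, hV, hx, fun z hz => hye.trans (h z hz)⟩
      · rintro ⟨V, hV, hx, h⟩
        exact hwb y V hV hx h
    rw [heq]
    exact ⟨hdir, hlub⟩

end RoughDomain
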